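/- arXiv:2603.09158 — 3 statements merged into one kernel-verified Lean document; each statement's English description precedes it below -/
import Mathlib

section
/- Let 𝐗 = (X,𝕏) be a level-2 α-Hölder rough path over V, let 𝐘 = (Y,Y') be an 𝐗-controlled rough path with values in W, and let F ∈ C_b^2(W,U). Then F(𝐘) := (F ∘ Y, t ↦ DF(Y_t) ∘ Y'_t) is an 𝐗-controlled rough path with values in U; that is, t ↦ DF(Y_t) ∘ Y'_t is α-Hölder as a map into L(V,U) and the remainder (s,t) ↦ F(Y_t) − F(Y_s) − (DF(Y_s) ∘ Y'_s)(X_{s,t}) is 2α-Hölder. -/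
/-!  Common definitions: level-2 rough paths, controlled rough paths,
compensated Riemann sums and rough integrals of a controlled rough path
against another controlled rough path. -/

open scoped BigOperators

noncomputable section

/-- `HBound T β A` : the two-parameter map `A` satisfies a `β`-Hölder bound on the
simplex `{0 ≤ s < t ≤ T}`. -/
def HBound {E : Type*} [NormedAddCommGroup E] (T β : ℝ) (A : ℝ → ℝ → E) : Prop :=
  ∃ C : ℝ, ∀ s t : ℝ, 0 ≤ s → s < t → t ≤ T → ‖A s t‖ ≤ C * (t - s) ^ β

/-- The Hölder seminorm `‖A‖_β = sup_{0 ≤ s < t ≤ T} ‖A_{s,t}‖ / (t-s)^β`, realised as the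
least admissible Hölder constant. -/
def hnorm {E : Type*} [NormedAddCommGroup E] (T β : ℝ) (A : ℝ → ℝ → E) : ℝ :=
  sInf {C : ℝ | 0 ≤ C ∧ ∀ s t : ℝ, 0 ≤ s → s < t → t ≤ T → ‖A s t‖ ≤ C * (t - s) ^ β}

/-- An abstract model of the projective tensor product `V ⊗̂ V`, bundling the canonical
bounded bilinear map `tmul : V × V → V ⊗̂ V` and the pairing `⋆` sending
`A ∈ L(V, L(W,U))` and `B ∈ L(V,W)` to the induced operator `A ⋆ B ∈ L(V ⊗̂ V, U)`,
characterised by `(A ⋆ B)(v₁ ⊗ v₂) = (A v₁)(B v₂)` and `‖A ⋆ B‖ ≤ ‖A‖ ‖B‖`. -/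
structure TensorOps (V V2 W U : Type*)
    [NormedAddCommGroup V] [NormedSpace ℝ V] [NormedAddCommGroup V2] [NormedSpace ℝ V2]
    [NormedAddCommGroup W] [NormedSpace ℝ W] [NormedAddCommGroup U] [NormedSpace ℝ U] where
  tmul : V →L[ℝ] V →L[ℝ] V2
  tmul_le : ∀ a b : V, ‖tmul a b‖ ≤ ‖a‖ * ‖b‖
  spair : (V →L[ℝ] (W →L[ℝ] U)) →L[ℝ] ((V →L[ℝ] W) →L[ℝ] (V2 →L[ℝ] U))
  spair_tmul : ∀ (A : V →L[ℝ] (W →L[ℝ] U)) (B : V →L[ℝ] W) (a b : V),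
    spair A B (tmul a b) = (A a) (B b)
  spair_le : ∀ (A : V →L[ℝ] (W →L[ℝ] U)) (B : V →L[ℝ] W), ‖spair A B‖ ≤ ‖A‖ * ‖B‖

section Defs

variable {V V2 E : Type*}
  [NormedAddCommGroup V] [NormedSpace ℝ V] [NormedAddCommGroup V2] [NormedSpace ℝ V2]
  [NormedAddCommGroup E] [NormedSpace ℝ E]

/-- `(X, XX)` is a level-2 `α`-Hölder rough path on `[0,T]`:
Chen's relation plus the analytic estimates. -/
structure IsRoughPath (T α : ℝ) (tmul : V →L[ℝ] V →L[ℝ] V2)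
    (X : ℝ → V) (XX : ℝ → ℝ → V2) : Prop where
  chen : ∀ s u t : ℝ, 0 ≤ s → s ≤ u → u ≤ t → t ≤ T →
    XX s t = XX s u + XX u t + tmul (X u - X s) (X t - X u)
  x_hold : HBound T α fun s t => X t - X s
  xx_hold : HBound T (2 * α) XX

/-- `‖𝐗‖_α := ‖X‖_α + ‖𝕏‖_{2α}`. -/
def rpNorm (T α : ℝ) (X : ℝ → V) (XX : ℝ → ℝ → V2) : ℝ :=
  hnorm T α (fun s t => X t - X s) + hnorm T (2 * α) XX

/-- `‖𝐗 − 𝐗̃‖_α := ‖X − X̃‖_α + ‖𝕏 − 𝕏̃‖_{2α}`. -/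
def rpDist (T α : ℝ) (X Xt : ℝ → V) (XX XXt : ℝ → ℝ → V2) : ℝ :=
  hnorm T α (fun s t => (X t - X s) - (Xt t - Xt s)) +
    hnorm T (2 * α) fun s t => XX s t - XXt s t

/-- The remainder `R^{𝐘}_{s,t} := Y_{s,t} − Y'_s(X_{s,t})` of a controlled rough path. -/
def Rem (X : ℝ → V) (Y : ℝ → E) (Y' : ℝ → V →L[ℝ] E) (s t : ℝ) : E :=
  Y t - Y s - Y' s (X t - X s)

/-- `(Y, Y')` is an `𝐗`-controlled rough path on `[0,T]` with values in `E`. -/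
structure IsCRP (T α : ℝ) (X : ℝ → V) (Y : ℝ → E) (Y' : ℝ → V →L[ℝ] E) : Prop where
  deriv_hold : HBound T α fun s t => Y' t - Y' s
  rem_hold : HBound T (2 * α) (Rem X Y Y')

/-- `‖𝐘‖_{𝐗;α} := ‖R^{𝐘}‖_{2α} + ‖Y'‖_α`. -/
def crpNorm (T α : ℝ) (X : ℝ → V) (Y : ℝ → E) (Y' : ℝ → V →L[ℝ] E) : ℝ :=
  hnorm T (2 * α) (Rem X Y Y') + hnorm T α fun s t => Y' t - Y' s

/-- `d_{𝐗,𝐗̃;α}(𝐘,𝐘̃) := ‖R^{𝐘} − R^{𝐘̃}‖_{2α} + ‖Y' − Ỹ'‖_α`. -/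
def crpDist (T α : ℝ) (X Xt : ℝ → V) (Y : ℝ → E) (Y' : ℝ → V →L[ℝ] E)
    (Yt : ℝ → E) (Yt' : ℝ → V →L[ℝ] E) : ℝ :=
  hnorm T (2 * α) (fun s t => Rem X Y Y' s t - Rem Xt Yt Yt' s t) +
    hnorm T α fun s t => (Y' t - Y' s) - (Yt' t - Yt' s)

/-- `p` is a finite partition `s = p 0 < p 1 < ⋯ < p n = t` of `[s,t]`. -/
def IsPartition (s t : ℝ) (n : ℕ) (p : ℕ → ℝ) : Prop :=
  p 0 = s ∧ p n = t ∧ ∀ i < n, p i < p (i + 1)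

end Defs

section Sums

variable {V V2 W U : Type*}
  [NormedAddCommGroup V] [NormedSpace ℝ V] [NormedAddCommGroup V2] [NormedSpace ℝ V2]
  [NormedAddCommGroup W] [NormedSpace ℝ W] [NormedAddCommGroup U] [NormedSpace ℝ U]

/-- The compensated Riemann sum
`∫_P Y dZ := Σ_i [ Y_{t_i}(Z_{t_i,t_{i+1}}) + (Y'_{t_i} ⋆ Z'_{t_i})(𝕏_{t_i,t_{i+1}}) ]`. -/
def rsum (tops : TensorOps V V2 W U) (XX : ℝ → ℝ → V2)
    (Y : ℝ → W →L[ℝ] U) (Y' : ℝ → V →L[ℝ] (W →L[ℝ] U))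
    (Z : ℝ → W) (Z' : ℝ → V →L[ℝ] W) (n : ℕ) (p : ℕ → ℝ) : U :=
  ∑ i ∈ Finset.range n,
    ((Y (p i)) (Z (p (i + 1)) - Z (p i)) +
      (tops.spair (Y' (p i)) (Z' (p i))) (XX (p i) (p (i + 1))))

/-- `I` is the rough integral `∫_s^t Y dZ`: the limit of the compensated Riemann sums
as the mesh of the partition tends to `0`. -/
def IsRoughIntegral (tops : TensorOps V V2 W U) (XX : ℝ → ℝ → V2)
    (Y : ℝ → W →L[ℝ] U) (Y' : ℝ → V →L[ℝ] (W →L[ℝ] U))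
    (Z : ℝ → W) (Z' : ℝ → V →L[ℝ] W) (s t : ℝ) (I : U) : Prop :=
  ∀ ε : ℝ, 0 < ε → ∃ δ : ℝ, 0 < δ ∧ ∀ (n : ℕ) (p : ℕ → ℝ), IsPartition s t n p →
    (∀ i < n, p (i + 1) - p i < δ) → ‖rsum tops XX Y Y' Z Z' n p - I‖ ≤ ε

end Sums

/-- The constant `C_α := (1 + T^α + T^{2α}) · 2^{3α} · Σ_{n≥1} n^{-3α}`. -/
def Calpha (T α : ℝ) : ℝ :=
  (1 + T ^ α + T ^ (2 * α)) * (2 : ℝ) ^ (3 * α) * ∑' n : ℕ, ((n : ℝ) + 1) ^ (-(3 * α))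

/-- `F ∈ C_b^k`: `k` times continuously Fréchet differentiable with all derivatives
up to order `k` bounded. -/
def IsCb {E₁ E₂ : Type*} [NormedAddCommGroup E₁] [NormedSpace ℝ E₁]
    [NormedAddCommGroup E₂] [NormedSpace ℝ E₂] (k : ℕ) (F : E₁ → E₂) : Prop :=
  ContDiff ℝ (k : ℕ∞) F ∧ ∀ j ≤ k, ∃ C : ℝ, ∀ x, ‖iteratedFDeriv ℝ j F x‖ ≤ C

/-- `‖F‖_{C_b^k} := Σ_{j=0}^k sup_x ‖D^j F(x)‖`. -/
def cbNorm {E₁ E₂ : Type*} [NormedAddCommGroup E₁] [NormedSpace ℝ E₁]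
    [NormedAddCommGroup E₂] [NormedSpace ℝ E₂] (k : ℕ) (F : E₁ → E₂) : ℝ :=
  ∑ j ∈ Finset.range (k + 1), ⨆ x : E₁, ‖iteratedFDeriv ℝ j F x‖

end

namespace HBound

variable {E : Type*} [NormedAddCommGroup E] {T β : ℝ} {A : ℝ → ℝ → E}

theorem exists_nonneg (h : HBound T β A) :
    ∃ C : ℝ, 0 ≤ C ∧ ∀ s t : ℝ, 0 ≤ s → s < t → t ≤ T → ‖A s t‖ ≤ C * (t - s) ^ β := by
  obtain ⟨C, hC⟩ := h
  refine ⟨|C|, abs_nonneg C, fun s t hs hst ht => (hC s t hs hst ht).trans ?_⟩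
  have : 0 ≤ (t - s) ^ β := Real.rpow_nonneg (sub_nonneg.2 hst.le) β
  gcongr
  exact le_abs_self C

/-- A Hölder path is bounded. -/
theorem exists_norm_le {f : ℝ → E} (hβ : 0 ≤ β) (h : HBound T β fun s t => f t - f s) :
    ∃ B : ℝ, 0 ≤ B ∧ ∀ s : ℝ, 0 ≤ s → s ≤ T → ‖f s‖ ≤ B := by
  obtain ⟨C, hC0, hC⟩ := h.exists_nonneg
  rcases lt_or_ge T 0 with hT | hT
  · exact ⟨0, le_rfl, fun s hs hsT => absurd (hs.trans hsT) hT.not_ge⟩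
  have hTβ : 0 ≤ T ^ β := Real.rpow_nonneg hT β
  refine ⟨‖f 0‖ + C * T ^ β, by positivity, fun s hs hsT => ?_⟩
  rcases hs.eq_or_lt with rfl | hs'
  · exact le_add_of_nonneg_right (by positivity)
  · have h1 : ‖f s - f 0‖ ≤ C * (s - 0) ^ β := hC 0 s le_rfl hs' hsT
    rw [sub_zero] at h1
    have h2 : s ^ β ≤ T ^ β := Real.rpow_le_rpow hs hsT hβ
    calc ‖f s‖ ≤ ‖f 0‖ + ‖f s - f 0‖ := norm_le_norm_add_norm_sub' _ _
      _ ≤ ‖f 0‖ + C * T ^ β := by gcongr; exact h1.trans (by gcongr)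

end HBound

namespace IsCb

variable {E₁ E₂ : Type*} [NormedAddCommGroup E₁] [NormedSpace ℝ E₁]
  [NormedAddCommGroup E₂] [NormedSpace ℝ E₂] {F : E₁ → E₂}

theorem exists_norm_fderiv_le (hF : IsCb 2 F) :
    ∃ M : ℝ, 0 ≤ M ∧ ∀ x, ‖fderiv ℝ F x‖ ≤ M := by
  obtain ⟨M, hM⟩ := hF.2 1 (by norm_num)
  have h : ∀ x, ‖fderiv ℝ F x‖ ≤ M := fun x => by
    simpa only [norm_iteratedFDeriv_one] using hM x
  exact ⟨M, (norm_nonneg _).trans (h 0), h⟩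

theorem exists_norm_fderiv_sub_le (hF : IsCb 2 F) :
    ∃ M : ℝ, 0 ≤ M ∧ ∀ x y, ‖fderiv ℝ F y - fderiv ℝ F x‖ ≤ M * ‖y - x‖ := by
  obtain ⟨M, hM⟩ := hF.2 2 le_rfl
  have h : ∀ x, ‖fderiv ℝ (fderiv ℝ F) x‖ ≤ M := fun x => by
    rw [← norm_iteratedFDeriv_one, norm_iteratedFDeriv_fderiv]
    exact hM x
  have hd : Differentiable ℝ (fderiv ℝ F) :=
    (hF.1.fderiv_right (m := 1) (by norm_num)).differentiable (by norm_num)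
  exact ⟨M, (norm_nonneg (fderiv ℝ (fderiv ℝ F) 0)).trans (h 0), fun x y =>
    convex_univ.norm_image_sub_le_of_norm_fderiv_le (fun z _ => hd z) (fun z _ => h z)
      (Set.mem_univ x) (Set.mem_univ y)⟩

end IsCb

/-- First-order Taylor estimate for a map with Lipschitz derivative. -/
theorem norm_sub_sub_fderiv_le {E₁ E₂ : Type*} [NormedAddCommGroup E₁] [NormedSpace ℝ E₁]
    [NormedAddCommGroup E₂] [NormedSpace ℝ E₂] {F : E₁ → E₂} {M : ℝ} (hM : 0 ≤ M)
    (hF : Differentiable ℝ F)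
    (hlip : ∀ x y, ‖fderiv ℝ F y - fderiv ℝ F x‖ ≤ M * ‖y - x‖) (x y : E₁) :
    ‖F y - F x - fderiv ℝ F x (y - x)‖ ≤ M * ‖y - x‖ ^ 2 := by
  have h := (convex_closedBall x ‖y - x‖).norm_image_sub_le_of_norm_fderiv_le'
    (f := F) (φ := fderiv ℝ F x) (C := M * ‖y - x‖) (fun z _ => hF z)
    (fun z hz => (hlip x z).trans (by
      have : ‖z - x‖ ≤ ‖y - x‖ := mem_closedBall_iff_norm.1 hz
      gcongr))
    (Metric.mem_closedBall_self (norm_nonneg _)) (mem_closedBall_iff_norm.2 le_rfl)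
  rwa [mul_assoc, ← sq] at h

/-- The base path of a controlled rough path is Hölder. -/
theorem IsCRP.path_hold {V E : Type*} [NormedAddCommGroup V] [NormedSpace ℝ V]
    [NormedAddCommGroup E] [NormedSpace ℝ E] {T α : ℝ} (hα : 0 ≤ α) {X : ℝ → V}
    (hX : HBound T α fun s t => X t - X s) {Y : ℝ → E} {Y' : ℝ → V →L[ℝ] E}
    (hY : IsCRP T α X Y Y') : HBound T α fun s t => Y t - Y s := by
  obtain ⟨B, hB0, hB⟩ := hY.deriv_hold.exists_norm_le hα
  obtain ⟨K, hK0, hK⟩ := hX.exists_nonneg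
  obtain ⟨R, hR0, hR⟩ := hY.rem_hold.exists_nonneg
  refine ⟨R * T ^ α + B * K, fun s t hs hst ht => ?_⟩
  have hts : 0 < t - s := sub_pos.2 hst
  have hle : (t - s) ^ α ≤ T ^ α := Real.rpow_le_rpow hts.le (by linarith) hα
  have h0 : 0 ≤ (t - s) ^ α := Real.rpow_nonneg hts.le α
  calc ‖Y t - Y s‖ = ‖Rem X Y Y' s t + Y' s (X t - X s)‖ := by rw [Rem, sub_add_cancel]
    _ ≤ ‖Rem X Y Y' s t‖ + ‖Y' s‖ * ‖X t - X s‖ :=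
      (norm_add_le _ _).trans (by gcongr; exact (Y' s).le_opNorm _)
    _ ≤ R * (t - s) ^ (2 * α) + B * (K * (t - s) ^ α) := by
      gcongr
      · exact hR s t hs hst ht
      · exact hB s hs (hst.le.trans ht)
      · exact hK s t hs hst ht
    _ = R * (t - s) ^ α * (t - s) ^ α + B * K * (t - s) ^ α := by
      rw [two_mul, Real.rpow_add hts]; ring
    _ ≤ R * T ^ α * (t - s) ^ α + B * K * (t - s) ^ α := by gcongr
    _ = (R * T ^ α + B * K) * (t - s) ^ α := by ring

/-- composition of a controlled rough path with a `C_b^2` map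
is a controlled rough path. -/
theorem stmt7
    {V V2 W U : Type*} [NormedAddCommGroup V] [NormedSpace ℝ V] [CompleteSpace V]
    [NormedAddCommGroup V2] [NormedSpace ℝ V2] [CompleteSpace V2]
    [NormedAddCommGroup W] [NormedSpace ℝ W] [CompleteSpace W]
    [NormedAddCommGroup U] [NormedSpace ℝ U] [CompleteSpace U]
    (T α : ℝ) (hT : 0 < T) (hα : 1 / 3 < α) (hα' : α ≤ 1 / 2)
    (tmul : V →L[ℝ] V →L[ℝ] V2) (htmul : ∀ a b : V, ‖tmul a b‖ ≤ ‖a‖ * ‖b‖)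
    (X : ℝ → V) (XX : ℝ → ℝ → V2) (hX : IsRoughPath T α tmul X XX)
    (Y : ℝ → W) (Y' : ℝ → V →L[ℝ] W) (hY : IsCRP T α X Y Y')
    (F : W → U) (hF : IsCb 2 F) :
    IsCRP T α X (fun t => F (Y t)) fun t => (fderiv ℝ F (Y t)).comp (Y' t) := by
  have hα0 : 0 ≤ α := by linarith
  obtain ⟨B, hB0, hB⟩ := hY.deriv_hold.exists_norm_le hα0
  obtain ⟨D, hD0, hD⟩ := hY.deriv_hold.exists_nonneg
  obtain ⟨R, hR0, hR⟩ := hY.rem_hold.exists_nonneg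
  obtain ⟨L, hL0, hL⟩ := (hY.path_hold hα0 hX.x_hold).exists_nonneg
  obtain ⟨M, hM0, hM⟩ := hF.exists_norm_fderiv_le
  obtain ⟨N, hN0, hN⟩ := hF.exists_norm_fderiv_sub_le
  constructor
  · refine ⟨M * D + N * L * B, fun s t hs hst ht => ?_⟩
    have h0 : 0 ≤ (t - s) ^ α := Real.rpow_nonneg (sub_nonneg.2 hst.le) α
    calc ‖(fderiv ℝ F (Y t)).comp (Y' t) - (fderiv ℝ F (Y s)).comp (Y' s)‖
        = ‖(fderiv ℝ F (Y t)).comp (Y' t - Y' s)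
            + (fderiv ℝ F (Y t) - fderiv ℝ F (Y s)).comp (Y' s)‖ := by
          rw [ContinuousLinearMap.comp_sub, ContinuousLinearMap.sub_comp, sub_add_sub_cancel]
      _ ≤ ‖fderiv ℝ F (Y t)‖ * ‖Y' t - Y' s‖
            + ‖fderiv ℝ F (Y t) - fderiv ℝ F (Y s)‖ * ‖Y' s‖ :=
          norm_add_le_of_le (ContinuousLinearMap.opNorm_comp_le _ _)
            (ContinuousLinearMap.opNorm_comp_le _ _)
      _ ≤ M * (D * (t - s) ^ α) + N * (L * (t - s) ^ α) * B := by
          gcongr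
          · exact hM _
          · exact hD s t hs hst ht
          · exact (hN _ _).trans (by gcongr; exact hL s t hs hst ht)
          · exact hB s hs (hst.le.trans ht)
      _ = (M * D + N * L * B) * (t - s) ^ α := by ring
  · refine ⟨N * L ^ 2 + M * R, fun s t hs hst ht => ?_⟩
    have hts : 0 < t - s := sub_pos.2 hst
    have h0 : 0 ≤ (t - s) ^ (2 * α) := Real.rpow_nonneg hts.le _
    have hd : Differentiable ℝ F := hF.1.differentiable (by norm_num)
    calc ‖Rem X (fun t => F (Y t)) (fun t => (fderiv ℝ F (Y t)).comp (Y' t)) s t‖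
        = ‖(F (Y t) - F (Y s) - fderiv ℝ F (Y s) (Y t - Y s))
            + fderiv ℝ F (Y s) (Rem X Y Y' s t)‖ := by
          congr 1
          simp only [Rem, ContinuousLinearMap.comp_apply, map_sub]
          abel
      _ ≤ N * ‖Y t - Y s‖ ^ 2 + ‖fderiv ℝ F (Y s)‖ * ‖Rem X Y Y' s t‖ :=
          norm_add_le_of_le (norm_sub_sub_fderiv_le hN0 hd hN _ _)
            (ContinuousLinearMap.le_opNorm _ _)
      _ ≤ N * (L * (t - s) ^ α) ^ 2 + M * (R * (t - s) ^ (2 * α)) := by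
          gcongr
          · exact hL s t hs hst ht
          · exact hM _
          · exact hR s t hs hst ht
      _ = (N * L ^ 2 + M * R) * (t - s) ^ (2 * α) := by
          rw [two_mul, Real.rpow_add hts]; ring
end

section
/- Let 𝐗 = (X,𝕏) be a level-2 α-Hölder rough path over V, let 𝐘 = (Y,Y') be an 𝐗-controlled rough path with values in U, let 𝐙 = (Z,Z') be an 𝐗-controlled rough path with values in W, and let F ∈ C_b^2(U, L(W,U)). Then the pair (t ↦ ∫_0^t F(Y_r) dZ_r, t ↦ F(Y_t) ∘ Z'_t) is an 𝐗-controlled rough path with values in U, where ∫_0^t F(Y_r) dZ_r denotes the rough integral of the 𝐗-controlled rough path (F ∘ Y, s ↦ DF(Y_s) ∘ Y'_s) against 𝐙. -/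
/-!  Common definitions: level-2 rough paths, controlled rough paths,
compensated Riemann sums and rough integrals of a controlled rough path
against another controlled rough path. -/

open scoped BigOperators

noncomputable section

section Sewing

variable {E : Type*} [NormedAddCommGroup E]

/-- Two partitions of adjacent intervals concatenate, and the associated Riemann sums add up. -/
theorem IsPartition.concat (Ξ : ℝ → ℝ → E) {s u t δ : ℝ} {m n : ℕ} {p q : ℕ → ℝ}
    (hp : IsPartition s u m p) (hq : IsPartition u t n q)
    (hpδ : ∀ i < m, p (i + 1) - p i ≤ δ) (hqδ : ∀ i < n, q (i + 1) - q i ≤ δ) :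
    ∃ r : ℕ → ℝ, IsPartition s t (m + n) r ∧ (∀ i < m + n, r (i + 1) - r i ≤ δ) ∧
      ∑ i ∈ Finset.range (m + n), Ξ (r i) (r (i + 1)) =
        ∑ i ∈ Finset.range m, Ξ (p i) (p (i + 1)) +
          ∑ i ∈ Finset.range n, Ξ (q i) (q (i + 1)) := by
  obtain ⟨hp0, hpm, hp⟩ := hp
  obtain ⟨hq0, hqn, hq⟩ := hq
  let r : ℕ → ℝ := fun i => if i ≤ m then p i else q (i - m)
  have hl : ∀ i ≤ m, r i = p i := fun i hi => if_pos hi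
  have hr : ∀ i, r (m + i) = q i := by
    intro i
    rcases Nat.eq_zero_or_pos i with rfl | hi
    · rw [add_zero, hl m le_rfl, hpm, hq0]
    · have h : ¬ m + i ≤ m := by omega
      simp [r, h]
  have hstep : ∀ P : ℝ → ℝ → Prop, (∀ i < m, P (p i) (p (i + 1))) →
      (∀ i < n, P (q i) (q (i + 1))) → ∀ i < m + n, P (r i) (r (i + 1)) := by
    intro P h₁ h₂ i hi
    rcases lt_or_ge i m with h | h
    · rw [hl i h.le, hl (i + 1) h]
      exact h₁ i h
    · obtain ⟨j, rfl⟩ := Nat.exists_eq_add_of_le h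
      rw [add_assoc, hr, hr]
      exact h₂ j (by omega)
  refine ⟨r, ⟨by rw [hl 0 (Nat.zero_le m), hp0], by rw [hr, hqn], hstep (· < ·) hp hq⟩,
    hstep (fun x y => y - x ≤ δ) hpδ hqδ, ?_⟩
  rw [Finset.sum_range_add]
  congr 1
  · refine Finset.sum_congr rfl fun i hi => ?_
    have hi := Finset.mem_range.1 hi
    rw [hl i hi.le, hl (i + 1) hi]
  · refine Finset.sum_congr rfl fun i _ => ?_
    rw [add_assoc, hr, hr]

/-- The constant `1 / (1 - 2^{1-θ})` of the sewing lemma. -/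
def sewingConst (θ : ℝ) : ℝ := 1 / (1 - 2 * (1 / 2 : ℝ) ^ θ)

theorem two_mul_half_rpow_lt_one {θ : ℝ} (hθ : 1 < θ) : 2 * (1 / 2 : ℝ) ^ θ < 1 := by
  have h := Real.rpow_lt_rpow_of_exponent_gt (x := 1 / 2) (by norm_num) (by norm_num) hθ
  rw [Real.rpow_one] at h
  linarith

theorem sewingConst_nonneg {θ : ℝ} (hθ : 1 < θ) : 0 ≤ sewingConst θ :=
  one_div_nonneg.2 (sub_nonneg.2 (two_mul_half_rpow_lt_one hθ).le)

theorem one_add_mul_sewingConst {θ : ℝ} (hθ : 1 < θ) :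
    1 + 2 * (1 / 2 : ℝ) ^ θ * sewingConst θ = sewingConst θ := by
  have h : 1 - 2 * (1 / 2 : ℝ) ^ θ ≠ 0 := (sub_pos.2 (two_mul_half_rpow_lt_one hθ)).ne'
  have h' : (1 - 2 * (1 / 2 : ℝ) ^ θ) * sewingConst θ = 1 := mul_one_div_cancel h
  linarith

/-- Dyadic Riemann sums of an almost additive germ stay close to the germ. -/
theorem exists_dyadic_partition {T K θ : ℝ} (hK : 0 ≤ K) (hθ : 1 < θ) (Ξ : ℝ → ℝ → E)
    (hΞ : ∀ s u t : ℝ, 0 ≤ s → s < u → u < t → t ≤ T →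
      ‖Ξ s t - Ξ s u - Ξ u t‖ ≤ K * (t - s) ^ θ) (k : ℕ) :
    ∀ s t : ℝ, 0 ≤ s → s < t → t ≤ T → ∃ (n : ℕ) (p : ℕ → ℝ), IsPartition s t n p ∧
      (∀ i < n, p (i + 1) - p i ≤ (t - s) / 2 ^ k) ∧
      ‖∑ i ∈ Finset.range n, Ξ (p i) (p (i + 1)) - Ξ s t‖ ≤
        sewingConst θ * K * (t - s) ^ θ := by
  induction k with
  | zero =>
    intro s t hs hst ht
    refine ⟨1, fun i => if i = 0 then s else t, ⟨by simp, by simp, ?_⟩, ?_, ?_⟩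
    · intro i hi
      obtain rfl : i = 0 := by omega
      simpa using hst
    · intro i hi
      obtain rfl : i = 0 := by omega
      simp
    · simp only [Finset.sum_range_one, if_true, zero_add, one_ne_zero, if_false, sub_self,
        norm_zero]
      exact mul_nonneg (mul_nonneg (sewingConst_nonneg hθ) hK)
        (Real.rpow_nonneg (sub_nonneg.2 hst.le) θ)
  | succ k ih =>
    intro s t hs hst ht
    obtain ⟨u, hu⟩ : ∃ u, u = (s + t) / 2 := ⟨_, rfl⟩
    have hsu : s < u := by linarith
    have hut : u < t := by linarith
    have h₁ : u - s = (t - s) * (1 / 2) := by rw [hu]; ring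
    have h₂ : t - u = (t - s) * (1 / 2) := by rw [hu]; ring
    obtain ⟨m, p, hp, hpδ, hpe⟩ := ih s u hs hsu (hut.le.trans ht)
    obtain ⟨n, q, hq, hqδ, hqe⟩ := ih u t (hs.trans hsu.le) hut ht
    have hδ : (t - s) * (1 / 2) / 2 ^ k = (t - s) / 2 ^ (k + 1) := by
      rw [pow_succ]; field_simp
    rw [h₁, hδ] at hpδ
    rw [h₂, hδ] at hqδ
    rw [h₁, Real.mul_rpow (sub_nonneg.2 hst.le) (by norm_num)] at hpe
    rw [h₂, Real.mul_rpow (sub_nonneg.2 hst.le) (by norm_num)] at hqe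
    obtain ⟨r, hr, hrδ, hre⟩ := hp.concat Ξ hq hpδ hqδ
    refine ⟨m + n, r, hr, hrδ, ?_⟩
    rw [hre]
    set A := ∑ i ∈ Finset.range m, Ξ (p i) (p (i + 1))
    set B := ∑ i ∈ Finset.range n, Ξ (q i) (q (i + 1))
    calc ‖A + B - Ξ s t‖
        = ‖(A - Ξ s u) + (B - Ξ u t) - (Ξ s t - Ξ s u - Ξ u t)‖ := by congr 1; abel
      _ ≤ ‖A - Ξ s u‖ + ‖B - Ξ u t‖ + ‖Ξ s t - Ξ s u - Ξ u t‖ :=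
        (norm_sub_le _ _).trans (by gcongr; exact norm_add_le _ _)
      _ ≤ sewingConst θ * K * ((t - s) ^ θ * (1 / 2) ^ θ) +
          sewingConst θ * K * ((t - s) ^ θ * (1 / 2) ^ θ) + K * (t - s) ^ θ :=
        add_le_add (add_le_add hpe hqe) (hΞ s u t hs hsu hut ht)
      _ = (1 + 2 * (1 / 2 : ℝ) ^ θ * sewingConst θ) * K * (t - s) ^ θ := by ring
      _ = sewingConst θ * K * (t - s) ^ θ := by rw [one_add_mul_sewingConst hθ]

/-- If the Riemann sums over `[0,t]` of an almost additive germ converge to `I t`, then the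
increments of `I` are approximated by the germ. -/
theorem norm_increment_sub_germ_le {T K θ : ℝ} (hK : 0 ≤ K) (hθ : 1 < θ) (Ξ : ℝ → ℝ → E)
    (hΞ : ∀ s u t : ℝ, 0 ≤ s → s < u → u < t → t ≤ T →
      ‖Ξ s t - Ξ s u - Ξ u t‖ ≤ K * (t - s) ^ θ) (I : ℝ → E)
    (hI : ∀ t : ℝ, 0 ≤ t → t ≤ T → ∀ ε : ℝ, 0 < ε → ∃ δ : ℝ, 0 < δ ∧
      ∀ (n : ℕ) (p : ℕ → ℝ), IsPartition 0 t n p → (∀ i < n, p (i + 1) - p i < δ) →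
        ‖∑ i ∈ Finset.range n, Ξ (p i) (p (i + 1)) - I t‖ ≤ ε)
    {s t : ℝ} (hs : 0 ≤ s) (hst : s < t) (ht : t ≤ T) :
    ‖I t - I s - Ξ s t‖ ≤ sewingConst θ * K * (t - s) ^ θ := by
  have hfine : ∀ δ : ℝ, 0 < δ → ∀ a b : ℝ, 0 ≤ a → a < b → b ≤ T →
      ∃ (n : ℕ) (p : ℕ → ℝ), IsPartition a b n p ∧ (∀ i < n, p (i + 1) - p i ≤ δ) ∧
      ‖∑ i ∈ Finset.range n, Ξ (p i) (p (i + 1)) - Ξ a b‖ ≤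
        sewingConst θ * K * (b - a) ^ θ := by
    intro δ hδ a b ha hab hb
    obtain ⟨k, hk⟩ := pow_unbounded_of_one_lt ((b - a) / δ) (one_lt_two (α := ℝ))
    obtain ⟨n, p, hp, hpδ, hpe⟩ := exists_dyadic_partition hK hθ Ξ hΞ k a b ha hab hb
    refine ⟨n, p, hp, fun i hi => (hpδ i hi).trans ?_, hpe⟩
    rw [div_le_iff₀ (by positivity)]
    rw [div_lt_iff₀ hδ] at hk
    linarith
  refine le_of_forall_pos_le_add fun ε hε => ?_
  obtain ⟨δ₁, hδ₁, h₁⟩ := hI s hs (hst.le.trans ht) (ε / 2) (half_pos hε)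
  obtain ⟨δ₂, hδ₂, h₂⟩ := hI t (hs.trans hst.le) ht (ε / 2) (half_pos hε)
  obtain ⟨δ, hδ, hδ'⟩ := exists_between (lt_min hδ₁ hδ₂)
  obtain ⟨m, p, hp, hpδ⟩ : ∃ (m : ℕ) (p : ℕ → ℝ), IsPartition 0 s m p ∧
      ∀ i < m, p (i + 1) - p i ≤ δ := by
    rcases hs.eq_or_lt with rfl | hs'
    · exact ⟨0, fun _ => 0, ⟨rfl, rfl, by simp⟩, by simp⟩
    · obtain ⟨m, p, hp, hpδ, -⟩ := hfine δ hδ 0 s le_rfl hs' (hst.le.trans ht)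
      exact ⟨m, p, hp, hpδ⟩
  obtain ⟨n, q, hq, hqδ, hqe⟩ := hfine δ hδ s t hs hst ht
  obtain ⟨r, hr, hrδ, hre⟩ := hp.concat Ξ hq hpδ hqδ
  have e₁ := h₁ m p hp fun i hi => (hpδ i hi).trans_lt (hδ'.trans_le (min_le_left _ _))
  have e₂ := h₂ _ r hr fun i hi => (hrδ i hi).trans_lt (hδ'.trans_le (min_le_right _ _))
  rw [hre] at e₂
  set A := ∑ i ∈ Finset.range m, Ξ (p i) (p (i + 1))
  set B := ∑ i ∈ Finset.range n, Ξ (q i) (q (i + 1))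
  calc ‖I t - I s - Ξ s t‖ = ‖(B - Ξ s t) + (A - I s) - (A + B - I t)‖ := by congr 1; abel
    _ ≤ ‖B - Ξ s t‖ + ‖A - I s‖ + ‖A + B - I t‖ :=
      (norm_sub_le _ _).trans (by gcongr; exact norm_add_le _ _)
    _ ≤ sewingConst θ * K * (t - s) ^ θ + ε := by linarith

end Sewing

section Holder

variable {E : Type*} [NormedAddCommGroup E]

/-- A Hölder bound passes to subintervals. -/
theorem HBound.exists_le {T β : ℝ} (hβ : 0 ≤ β) {A : ℝ → ℝ → E} (h : HBound T β A) :
    ∃ C : ℝ, 0 ≤ C ∧ ∀ s u v t : ℝ, 0 ≤ s → s ≤ u → u < v → v ≤ t → t ≤ T →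
      ‖A u v‖ ≤ C * (t - s) ^ β := by
  obtain ⟨C, hC⟩ := h
  refine ⟨|C|, abs_nonneg C, fun s u v t hs hsu huv hvt ht => ?_⟩
  have huv' : 0 ≤ v - u := sub_nonneg.2 huv.le
  calc ‖A u v‖ ≤ C * (v - u) ^ β := hC u v (hs.trans hsu) huv (hvt.trans ht)
    _ ≤ |C| * (v - u) ^ β := by gcongr; exact le_abs_self C
    _ ≤ |C| * (t - s) ^ β := by gcongr

theorem HBound.exists_le_sq {T α : ℝ} (hα : 0 ≤ α) {A : ℝ → ℝ → E}
    (h : HBound T (2 * α) A) :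
    ∃ C : ℝ, 0 ≤ C ∧ ∀ s u v t : ℝ, 0 ≤ s → s ≤ u → u < v → v ≤ t → t ≤ T →
      ‖A u v‖ ≤ C * ((t - s) ^ α) ^ 2 := by
  obtain ⟨C, hC0, hC⟩ := h.exists_le (by positivity)
  refine ⟨C, hC0, fun s u v t hs hsu huv hvt ht => ?_⟩
  rw [← Real.rpow_mul_natCast (by linarith), mul_comm α]
  exact hC s u v t hs hsu huv hvt ht

/-- A path with Hölder increments is bounded. -/
theorem HBound.exists_norm_le_s8 {T β : ℝ} (hT : 0 ≤ T) (hβ : 0 ≤ β) {f : ℝ → E}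
    (h : HBound T β fun s t => f t - f s) :
    ∃ M : ℝ, 0 ≤ M ∧ ∀ t : ℝ, 0 ≤ t → t ≤ T → ‖f t‖ ≤ M := by
  obtain ⟨C, hC0, hC⟩ := h.exists_le hβ
  have hTβ : 0 ≤ T ^ β := Real.rpow_nonneg hT β
  refine ⟨‖f 0‖ + C * T ^ β, by positivity, fun t ht htT => ?_⟩
  rcases ht.eq_or_lt with rfl | ht
  · have : 0 ≤ C * T ^ β := by positivity
    linarith
  · have h₁ := hC 0 0 t T le_rfl le_rfl ht htT le_rfl
    have h₂ := norm_le_norm_add_norm_sub (f 0) (f t)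
    rw [sub_zero] at h₁
    rw [norm_sub_rev] at h₂
    linarith

end Holder

section Controlled

variable {V V2 W U E : Type*}
  [NormedAddCommGroup V] [NormedSpace ℝ V] [NormedAddCommGroup V2] [NormedSpace ℝ V2]
  [NormedAddCommGroup W] [NormedSpace ℝ W] [NormedAddCommGroup U] [NormedSpace ℝ U]
  [NormedAddCommGroup E] [NormedSpace ℝ E]

/-- The path component of a controlled rough path is `α`-Hölder. -/
theorem IsCRP.hBound {T α : ℝ} (hT : 0 ≤ T) (hα : 0 ≤ α) {X : ℝ → V}
    (hX : HBound T α fun s t => X t - X s) {Y : ℝ → E} {Y' : ℝ → V →L[ℝ] E}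
    (hY : IsCRP T α X Y Y') : HBound T α fun s t => Y t - Y s := by
  obtain ⟨M, hM0, hM⟩ := hY.deriv_hold.exists_norm_le_s8 hT hα
  obtain ⟨C, hC0, hC⟩ := hX.exists_le hα
  obtain ⟨R, hR0, hR⟩ := hY.rem_hold.exists_le_sq hα
  refine ⟨M * C + R * T ^ α, fun s t hs hst ht => ?_⟩
  have h₁ := hC s s t t hs le_rfl hst le_rfl ht
  have h₂ := hR s s t t hs le_rfl hst le_rfl ht
  have h₃ : (t - s) ^ α ≤ T ^ α := by
    have : 0 ≤ t - s := by linarith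
    gcongr
    linarith
  have ha : 0 ≤ (t - s) ^ α := Real.rpow_nonneg (by linarith) α
  set a := (t - s) ^ α
  calc ‖Y t - Y s‖ = ‖Y' s (X t - X s) + Rem X Y Y' s t‖ := by
        congr 1; simp only [Rem]; abel
    _ ≤ ‖Y' s‖ * ‖X t - X s‖ + ‖Rem X Y Y' s t‖ :=
      (norm_add_le _ _).trans (by gcongr; exact (Y' s).le_opNorm _)
    _ ≤ M * (C * a) + R * (T ^ α * a) := by
      gcongr
      · exact hM s hs (hst.le.trans ht)
      · refine h₂.trans ?_
        rw [sq]
        gcongr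
    _ = (M * C + R * T ^ α) * a := by ring

theorem IsCb.exists_fderiv_bounds {F : U → E} (hF : IsCb 2 F) :
    ∃ C : ℝ, 0 ≤ C ∧ (∀ x, ‖fderiv ℝ F x‖ ≤ C) ∧
      (∀ x y, ‖fderiv ℝ F y - fderiv ℝ F x‖ ≤ C * ‖y - x‖) ∧
      (∀ x y, ‖F y - F x - fderiv ℝ F x (y - x)‖ ≤ C * ‖y - x‖ ^ 2) := by
  obtain ⟨hF, hb⟩ := hF
  obtain ⟨C₁, hC₁⟩ := hb 1 (by norm_num)
  obtain ⟨C₂, hC₂⟩ := hb 2 le_rfl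
  have hF : ContDiff ℝ 2 F := hF
  have hd : Differentiable ℝ F := hF.differentiable (by norm_num)
  have hd' : Differentiable ℝ (fderiv ℝ F) :=
    (hF.fderiv_right (m := 1) (by norm_num)).differentiable (by norm_num)
  have hb₁ : ∀ x, ‖fderiv ℝ F x‖ ≤ C₁ := fun x => by
    rw [← norm_iteratedFDeriv_one]
    exact hC₁ x
  have hb₂ : ∀ x, ‖fderiv ℝ (fderiv ℝ F) x‖ ≤ C₂ := fun x => by
    rw [← norm_iteratedFDeriv_one, norm_iteratedFDeriv_fderiv]
    exact hC₂ x
  have hC₂0 : 0 ≤ C₂ := le_trans (norm_nonneg (fderiv ℝ (fderiv ℝ F) 0)) (hb₂ 0)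
  have hlip : ∀ x y, ‖fderiv ℝ F y - fderiv ℝ F x‖ ≤ C₂ * ‖y - x‖ := fun x y =>
    convex_univ.norm_image_sub_le_of_norm_fderiv_le (𝕜 := ℝ) (fun z _ => hd' z)
      (fun z _ => hb₂ z) (Set.mem_univ x) (Set.mem_univ y)
  refine ⟨max C₁ C₂, le_max_of_le_right hC₂0, fun x => (hb₁ x).trans (le_max_left _ _),
    fun x y => (hlip x y).trans (by gcongr; exact le_max_right _ _), fun x y => ?_⟩
  have h := (convex_closedBall x ‖y - x‖).norm_image_sub_le_of_norm_fderiv_le' (𝕜 := ℝ)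
    (f := F) (φ := fderiv ℝ F x) (C := C₂ * ‖y - x‖) (x := x) (y := y) (fun z _ => hd z)
    (fun z hz => (hlip x z).trans (by gcongr; exact mem_closedBall_iff_norm.1 hz))
    (Metric.mem_closedBall_self (norm_nonneg _)) (mem_closedBall_iff_norm.2 le_rfl)
  calc _ ≤ C₂ * ‖y - x‖ * ‖y - x‖ := h
    _ = C₂ * ‖y - x‖ ^ 2 := by ring
    _ ≤ max C₁ C₂ * ‖y - x‖ ^ 2 := by gcongr; exact le_max_right _ _

/-- The composition of a controlled rough path with a `C_b^2` map is controlled. -/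
theorem IsCRP.comp_isCb {T α : ℝ} (hT : 0 ≤ T) (hα : 0 ≤ α) {X : ℝ → V}
    (hX : HBound T α fun s t => X t - X s) {Y : ℝ → U} {Y' : ℝ → V →L[ℝ] U}
    (hY : IsCRP T α X Y Y') {F : U → E} (hF : IsCb 2 F) :
    IsCRP T α X (fun r => F (Y r)) fun r => (fderiv ℝ F (Y r)).comp (Y' r) := by
  obtain ⟨C, hC0, hC₁, hC₂, hC₃⟩ := hF.exists_fderiv_bounds
  obtain ⟨M, hM0, hM⟩ := hY.deriv_hold.exists_norm_le_s8 hT hα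
  obtain ⟨D, hD0, hD⟩ := hY.deriv_hold.exists_le hα
  obtain ⟨R, hR0, hR⟩ := hY.rem_hold.exists_le_sq hα
  obtain ⟨H, hH0, hH⟩ := (hY.hBound hT hα hX).exists_le hα
  constructor
  · refine ⟨C * D + C * H * M, fun s t hs hst ht => ?_⟩
    have h₁ := hD s s t t hs le_rfl hst le_rfl ht
    have h₂ := hH s s t t hs le_rfl hst le_rfl ht
    have ha : 0 ≤ (t - s) ^ α := Real.rpow_nonneg (by linarith) α
    set a := (t - s) ^ α
    calc ‖(fderiv ℝ F (Y t)).comp (Y' t) - (fderiv ℝ F (Y s)).comp (Y' s)‖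
        = ‖(fderiv ℝ F (Y t)).comp (Y' t - Y' s) +
            (fderiv ℝ F (Y t) - fderiv ℝ F (Y s)).comp (Y' s)‖ := by
          congr 1; ext v; simp
      _ ≤ ‖fderiv ℝ F (Y t)‖ * ‖Y' t - Y' s‖ +
            ‖fderiv ℝ F (Y t) - fderiv ℝ F (Y s)‖ * ‖Y' s‖ :=
        (norm_add_le _ _).trans (add_le_add (ContinuousLinearMap.opNorm_comp_le _ _)
          (ContinuousLinearMap.opNorm_comp_le _ _))
      _ ≤ C * (D * a) + C * (H * a) * M := by
        gcongr
        · exact hC₁ _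
        · exact (hC₂ _ _).trans (by gcongr)
        · exact hM s hs (hst.le.trans ht)
      _ = (C * D + C * H * M) * a := by ring
  · refine ⟨C * H ^ 2 + C * R, fun s t hs hst ht => ?_⟩
    have h₁ := hR s s t t hs le_rfl hst le_rfl ht
    have h₂ := hH s s t t hs le_rfl hst le_rfl ht
    rw [mul_comm 2 α, show (t - s) ^ (α * 2) = ((t - s) ^ α) ^ 2 from
      mod_cast Real.rpow_mul_natCast (by linarith : 0 ≤ t - s) α 2]
    set a := (t - s) ^ α
    calc ‖Rem X (fun r => F (Y r)) (fun r => (fderiv ℝ F (Y r)).comp (Y' r)) s t‖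
        = ‖(F (Y t) - F (Y s) - fderiv ℝ F (Y s) (Y t - Y s)) +
            fderiv ℝ F (Y s) (Rem X Y Y' s t)‖ := by
          congr 1
          simp only [Rem, ContinuousLinearMap.comp_apply, map_sub]
          abel
      _ ≤ C * ‖Y t - Y s‖ ^ 2 + ‖fderiv ℝ F (Y s)‖ * ‖Rem X Y Y' s t‖ :=
        (norm_add_le _ _).trans
          (add_le_add (hC₃ _ _) (ContinuousLinearMap.le_opNorm _ _))
      _ ≤ C * (H * a) ^ 2 + C * (R * a ^ 2) := by
        gcongr
        exact hC₁ _
      _ = (C * H ^ 2 + C * R) * a ^ 2 := by ring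

theorem TensorOps.norm_spair_apply_le (tops : TensorOps V V2 W U)
    (A : V →L[ℝ] W →L[ℝ] U) (B : V →L[ℝ] W) (x : V2) :
    ‖tops.spair A B x‖ ≤ ‖A‖ * ‖B‖ * ‖x‖ :=
  (ContinuousLinearMap.le_opNorm _ _).trans (by gcongr; exact tops.spair_le A B)

/-- The summand `Y_s(Z_{s,t}) + (Y'_s ⋆ Z'_s)(𝕏_{s,t})` of the compensated Riemann sums. -/
def roughGerm (tops : TensorOps V V2 W U) (XX : ℝ → ℝ → V2)
    (Y : ℝ → W →L[ℝ] U) (Y' : ℝ → V →L[ℝ] (W →L[ℝ] U))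
    (Z : ℝ → W) (Z' : ℝ → V →L[ℝ] W) (s t : ℝ) : U :=
  Y s (Z t - Z s) + tops.spair (Y' s) (Z' s) (XX s t)

/-- The germ of the rough integral is almost additive, with exponent `3α`. -/
theorem exists_roughGerm_defect_le {T α : ℝ} (hT : 0 ≤ T) (hα : 0 ≤ α)
    (tops : TensorOps V V2 W U) {X : ℝ → V} {XX : ℝ → ℝ → V2}
    (hX : IsRoughPath T α tops.tmul X XX)
    {Y : ℝ → W →L[ℝ] U} {Y' : ℝ → V →L[ℝ] (W →L[ℝ] U)} (hY : IsCRP T α X Y Y')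
    {Z : ℝ → W} {Z' : ℝ → V →L[ℝ] W} (hZ : IsCRP T α X Z Z') :
    ∃ K : ℝ, 0 ≤ K ∧ ∀ s u t : ℝ, 0 ≤ s → s < u → u < t → t ≤ T →
      ‖roughGerm tops XX Y Y' Z Z' s t - roughGerm tops XX Y Y' Z Z' s u -
        roughGerm tops XX Y Y' Z Z' u t‖ ≤ K * (t - s) ^ (3 * α) := by
  obtain ⟨M, hM0, hM⟩ := hY.deriv_hold.exists_norm_le_s8 hT hα
  obtain ⟨N, hN0, hN⟩ := hZ.deriv_hold.exists_norm_le_s8 hT hα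
  obtain ⟨D, hD0, hD⟩ := hY.deriv_hold.exists_le hα
  obtain ⟨D', hD'0, hD'⟩ := hZ.deriv_hold.exists_le hα
  obtain ⟨R, hR0, hR⟩ := hY.rem_hold.exists_le_sq hα
  obtain ⟨R', hR'0, hR'⟩ := hZ.rem_hold.exists_le_sq hα
  obtain ⟨H, hH0, hH⟩ := (hZ.hBound hT hα hX.x_hold).exists_le hα
  obtain ⟨C, hC0, hC⟩ := hX.x_hold.exists_le hα
  obtain ⟨C', hC'0, hC'⟩ := hX.xx_hold.exists_le_sq hα
  refine ⟨R * H + M * C * R' + M * C * D' * C + D * N * C' + M * D' * C', by positivity,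
    fun s u t hs hsu hut ht => ?_⟩
  have b₁ := hR s s u t hs le_rfl hsu hut.le ht
  have b₂ := hH s u t t hs hsu.le hut le_rfl ht
  have b₃ := hM s hs (by linarith)
  have b₄ := hC s s u t hs le_rfl hsu hut.le ht
  have b₅ := hR' s u t t hs hsu.le hut le_rfl ht
  have b₆ := hD' s s u t hs le_rfl hsu hut.le ht
  have b₇ := hC s u t t hs hsu.le hut le_rfl ht
  have b₈ := hD s s u t hs le_rfl hsu hut.le ht
  have b₉ := hN u (by linarith) (by linarith)
  have b₁₀ := hC' s u t t hs hsu.le hut le_rfl ht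
  have ha : 0 ≤ (t - s) ^ α := Real.rpow_nonneg (by linarith) α
  rw [mul_comm 3 α, show (t - s) ^ (α * 3) = ((t - s) ^ α) ^ 3 from
    mod_cast Real.rpow_mul_natCast (by linarith : 0 ≤ t - s) α 3]
  set a := (t - s) ^ α
  have key : roughGerm tops XX Y Y' Z Z' s t - roughGerm tops XX Y Y' Z Z' s u -
      roughGerm tops XX Y Y' Z Z' u t =
      -(Rem X Y Y' s u (Z t - Z u) + Y' s (X u - X s) (Rem X Z Z' u t) +
        Y' s (X u - X s) ((Z' u - Z' s) (X t - X u)) +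
        tops.spair (Y' u - Y' s) (Z' u) (XX u t) +
        tops.spair (Y' s) (Z' u - Z' s) (XX u t)) := by
    simp only [roughGerm, hX.chen s u t hs hsu.le hut.le ht, map_add, tops.spair_tmul, Rem,
      map_sub, sub_apply]
    abel
  have n₁ : ‖Rem X Y Y' s u (Z t - Z u)‖ ≤ R * a ^ 2 * (H * a) :=
    (ContinuousLinearMap.le_opNorm _ _).trans (by gcongr)
  have n₂ : ‖Y' s (X u - X s)‖ ≤ M * (C * a) :=
    (ContinuousLinearMap.le_opNorm _ _).trans (by gcongr)
  have n₃ : ‖Y' s (X u - X s) (Rem X Z Z' u t)‖ ≤ M * (C * a) * (R' * a ^ 2) :=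
    (ContinuousLinearMap.le_opNorm _ _).trans (by gcongr)
  have n₄ : ‖(Z' u - Z' s) (X t - X u)‖ ≤ D' * a * (C * a) :=
    (ContinuousLinearMap.le_opNorm _ _).trans (by gcongr)
  have n₅ : ‖Y' s (X u - X s) ((Z' u - Z' s) (X t - X u))‖ ≤
      M * (C * a) * (D' * a * (C * a)) :=
    (ContinuousLinearMap.le_opNorm _ _).trans (by gcongr)
  have n₆ : ‖tops.spair (Y' u - Y' s) (Z' u) (XX u t)‖ ≤ D * a * N * (C' * a ^ 2) :=
    (tops.norm_spair_apply_le _ _ _).trans (by gcongr)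
  have n₇ : ‖tops.spair (Y' s) (Z' u - Z' s) (XX u t)‖ ≤ M * (D' * a) * (C' * a ^ 2) :=
    (tops.norm_spair_apply_le _ _ _).trans (by gcongr)
  rw [key, norm_neg]
  refine (norm_add_le_of_le (norm_add_le_of_le (norm_add_le_of_le
    (norm_add_le_of_le n₁ n₃) n₅) n₆) n₇).trans (le_of_eq ?_)
  ring

/-- The rough integral of controlled rough paths is a controlled rough path. -/
theorem IsCRP.roughIntegral {T α : ℝ} (hT : 0 ≤ T) (hα : 1 / 3 < α)
    (tops : TensorOps V V2 W U) {X : ℝ → V} {XX : ℝ → ℝ → V2}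
    (hX : IsRoughPath T α tops.tmul X XX)
    {Y : ℝ → W →L[ℝ] U} {Y' : ℝ → V →L[ℝ] (W →L[ℝ] U)} (hY : IsCRP T α X Y Y')
    {Z : ℝ → W} {Z' : ℝ → V →L[ℝ] W} (hZ : IsCRP T α X Z Z') {I : ℝ → U}
    (hI : ∀ t : ℝ, 0 ≤ t → t ≤ T → IsRoughIntegral tops XX Y Y' Z Z' 0 t (I t)) :
    IsCRP T α X I fun t => (Y t).comp (Z' t) := by
  have hα0 : 0 ≤ α := by linarith
  obtain ⟨K, hK0, hK⟩ := exists_roughGerm_defect_le hT hα0 tops hX hY hZ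
  have hθ : 1 < 3 * α := by linarith
  have hsew := fun s t hs hst ht =>
    norm_increment_sub_germ_le hK0 hθ _ hK I hI (s := s) (t := t) hs hst ht
  have hS0 := sewingConst_nonneg hθ
  set S := sewingConst (3 * α)
  obtain ⟨L, hL0, hL⟩ := (hY.hBound hT hα0 hX.x_hold).exists_norm_le_s8 hT hα0
  obtain ⟨H, hH0, hH⟩ := (hY.hBound hT hα0 hX.x_hold).exists_le hα0
  obtain ⟨M, hM0, hM⟩ := hY.deriv_hold.exists_norm_le_s8 hT hα0
  obtain ⟨N, hN0, hN⟩ := hZ.deriv_hold.exists_norm_le_s8 hT hα0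
  obtain ⟨D, hD0, hD⟩ := hZ.deriv_hold.exists_le hα0
  obtain ⟨R, hR0, hR⟩ := hZ.rem_hold.exists_le_sq hα0
  obtain ⟨C, hC0, hC⟩ := hX.xx_hold.exists_le_sq hα0
  constructor
  · refine ⟨L * D + H * N, fun s t hs hst ht => ?_⟩
    have h₁ := hL t (by linarith) ht
    have h₂ := hD s s t t hs le_rfl hst le_rfl ht
    have h₃ := hH s s t t hs le_rfl hst le_rfl ht
    have h₄ := hN s hs (by linarith)
    have ha : 0 ≤ (t - s) ^ α := Real.rpow_nonneg (by linarith) α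
    set a := (t - s) ^ α
    calc ‖(Y t).comp (Z' t) - (Y s).comp (Z' s)‖
        = ‖(Y t).comp (Z' t - Z' s) + (Y t - Y s).comp (Z' s)‖ := by
          congr 1; ext v; simp
      _ ≤ ‖Y t‖ * ‖Z' t - Z' s‖ + ‖Y t - Y s‖ * ‖Z' s‖ :=
        (norm_add_le _ _).trans (add_le_add (ContinuousLinearMap.opNorm_comp_le _ _)
          (ContinuousLinearMap.opNorm_comp_le _ _))
      _ ≤ L * (D * a) + H * a * N := by gcongr
      _ = (L * D + H * N) * a := by ring
  · refine ⟨S * K * T ^ α + L * R + M * N * C, fun s t hs hst ht => ?_⟩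
    have h₀ := hsew s t hs hst ht
    have h₁ := hL s hs (by linarith)
    have h₂ := hR s s t t hs le_rfl hst le_rfl ht
    have h₃ := hM s hs (by linarith)
    have h₄ := hN s hs (by linarith)
    have h₅ := hC s s t t hs le_rfl hst le_rfl ht
    have h₆ : (t - s) ^ α ≤ T ^ α := Real.rpow_le_rpow (by linarith) (by linarith) hα0
    rw [mul_comm 3 α, show (t - s) ^ (α * 3) = ((t - s) ^ α) ^ 3 from
      mod_cast Real.rpow_mul_natCast (by linarith : 0 ≤ t - s) α 3] at h₀
    rw [mul_comm 2 α, show (t - s) ^ (α * 2) = ((t - s) ^ α) ^ 2 from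
      mod_cast Real.rpow_mul_natCast (by linarith : 0 ≤ t - s) α 2]
    set a := (t - s) ^ α
    have n₁ : ‖Y s (Rem X Z Z' s t)‖ ≤ L * (R * a ^ 2) :=
      (ContinuousLinearMap.le_opNorm _ _).trans (by gcongr)
    have n₂ : ‖tops.spair (Y' s) (Z' s) (XX s t)‖ ≤ M * N * (C * a ^ 2) :=
      (tops.norm_spair_apply_le _ _ _).trans (by gcongr)
    calc ‖Rem X I (fun t => (Y t).comp (Z' t)) s t‖
        = ‖(I t - I s - roughGerm tops XX Y Y' Z Z' s t) + Y s (Rem X Z Z' s t) +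
            tops.spair (Y' s) (Z' s) (XX s t)‖ := by
          congr 1
          simp only [Rem, roughGerm, ContinuousLinearMap.comp_apply, map_sub]
          abel
      _ ≤ S * K * a ^ 3 + L * (R * a ^ 2) + M * N * (C * a ^ 2) :=
        norm_add_le_of_le (norm_add_le_of_le h₀ n₁) n₂
      _ = S * K * (a * a ^ 2) + L * (R * a ^ 2) + M * N * (C * a ^ 2) := by ring
      _ ≤ S * K * (T ^ α * a ^ 2) + L * (R * a ^ 2) + M * N * (C * a ^ 2) := by gcongr
      _ = (S * K * T ^ α + L * R + M * N * C) * a ^ 2 := by ring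

end Controlled

end

/-- the rough integral `∫₀^· F(Y) dZ`, together with the Gubinelli
derivative `t ↦ F(Y_t) ∘ Z'_t`, is a controlled rough path. -/
theorem stmt8
    {V V2 W U : Type*} [NormedAddCommGroup V] [NormedSpace ℝ V] [CompleteSpace V]
    [NormedAddCommGroup V2] [NormedSpace ℝ V2] [CompleteSpace V2]
    [NormedAddCommGroup W] [NormedSpace ℝ W] [CompleteSpace W]
    [NormedAddCommGroup U] [NormedSpace ℝ U] [CompleteSpace U]
    (T α : ℝ) (hT : 0 < T) (hα : 1 / 3 < α) (hα' : α ≤ 1 / 2)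
    (tops : TensorOps V V2 W U) (X : ℝ → V) (XX : ℝ → ℝ → V2)
    (hX : IsRoughPath T α tops.tmul X XX)
    (Y : ℝ → U) (Y' : ℝ → V →L[ℝ] U) (hY : IsCRP T α X Y Y')
    (Z : ℝ → W) (Z' : ℝ → V →L[ℝ] W) (hZ : IsCRP T α X Z Z')
    (F : U → W →L[ℝ] U) (hF : IsCb 2 F)
    (I : ℝ → U)
    (hI : ∀ t : ℝ, 0 ≤ t → t ≤ T →
      IsRoughIntegral tops XX (fun r => F (Y r))
        (fun r => (fderiv ℝ F (Y r)).comp (Y' r)) Z Z' 0 t (I t)) :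
    IsCRP T α X I fun t => (F (Y t)).comp (Z' t) :=
  (hY.comp_isCb hT.le (by linarith) hX.x_hold hF).roughIntegral hT.le hα tops hX hZ hI
end

section
/- For every K > 0 there exists a constant C > 0 such that the following holds: for every level-2 α-Hölder rough path 𝐗 over V with ‖𝐗‖_α ≤ K, all 𝐗-controlled rough paths 𝐘 = (Y,Y') and 𝐘̃ = (Ỹ,Ỹ') with values in W satisfying ‖Y'_0‖ ≤ K, ‖Ỹ'_0‖ ≤ K, ‖𝐘‖_{𝐗;α} ≤ K and ‖𝐘̃‖_{𝐗;α} ≤ K, and every F ∈ C_b^3(W,U): ‖F(𝐘) − F(𝐘̃)‖_{𝐗;α} ≤ C ‖F‖_{C_b^3} ( ‖𝐘 − 𝐘̃‖_{𝐗;α} + ‖Y_0 − Ỹ_0‖ + ‖Y'_0 − Ỹ'_0‖ ), where F(𝐘) := (F ∘ Y, t ↦ DF(Y_t) ∘ Y'_t) and similarly for F(𝐘̃). -/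
/-!  Common definitions: level-2 rough paths, controlled rough paths,
compensated Riemann sums and rough integrals of a controlled rough path
against another controlled rough path. -/

open scoped BigOperators

section HolderSeminorm

variable {E : Type*} [NormedAddCommGroup E] {T β : ℝ} {A : ℝ → ℝ → E}

theorem hnorm_nonneg : 0 ≤ hnorm T β A :=
  Real.sInf_nonneg fun _ h => h.1

theorem hnorm_le {C : ℝ} (hC : 0 ≤ C)
    (h : ∀ s t : ℝ, 0 ≤ s → s < t → t ≤ T → ‖A s t‖ ≤ C * (t - s) ^ β) : hnorm T β A ≤ C :=
  csInf_le ⟨0, fun _ h => h.1⟩ ⟨hC, h⟩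

theorem HBound.norm_le (h : HBound T β A) {s t : ℝ} (hs : 0 ≤ s) (hst : s < t) (ht : t ≤ T) :
    ‖A s t‖ ≤ hnorm T β A * (t - s) ^ β := by
  have hpos : 0 < (t - s) ^ β := Real.rpow_pos_of_pos (sub_pos.2 hst) _
  rw [← div_le_iff₀ hpos]
  refine le_csInf ?_ fun C hC => (div_le_iff₀ hpos).2 (hC.2 s t hs hst ht)
  obtain ⟨C, hC⟩ := h
  refine ⟨|C|, abs_nonneg C, fun u v hu huv hv => (hC u v hu huv hv).trans ?_⟩
  exact mul_le_mul_of_nonneg_right (le_abs_self C) (Real.rpow_nonneg (sub_pos.2 huv).le _)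

theorem HBound.sub {B : ℝ → ℝ → E} (hA : HBound T β A) (hB : HBound T β B) :
    HBound T β fun s t => A s t - B s t := by
  obtain ⟨C, hC⟩ := hA
  obtain ⟨C', hC'⟩ := hB
  refine ⟨C + C', fun s t hs hst ht => (norm_sub_le _ _).trans ?_⟩
  rw [add_mul]
  exact add_le_add (hC s t hs hst ht) (hC' s t hs hst ht)

theorem norm_le_of_holder {Z : ℝ → E} {C : ℝ} (hβ : 0 ≤ β) (hC : 0 ≤ C)
    (h : ∀ s t : ℝ, 0 ≤ s → s < t → t ≤ T → ‖Z t - Z s‖ ≤ C * (t - s) ^ β)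
    {t : ℝ} (ht : 0 ≤ t) (htT : t ≤ T) : ‖Z t‖ ≤ ‖Z 0‖ + C * T ^ β := by
  have hT : 0 ≤ C * T ^ β := mul_nonneg hC (Real.rpow_nonneg (ht.trans htT) _)
  rcases ht.eq_or_lt with rfl | hpos
  · linarith
  · have h₁ := h 0 t le_rfl hpos htT
    have h₂ : C * (t - 0) ^ β ≤ C * T ^ β := by
      rw [sub_zero]
      gcongr
    have h₃ := norm_le_norm_add_norm_sub' (Z t) (Z 0)
    linarith

end HolderSeminorm

section SmoothBounds

variable {E₁ E₂ : Type*} [NormedAddCommGroup E₁] [NormedSpace ℝ E₁]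
  [NormedAddCommGroup E₂] [NormedSpace ℝ E₂]

theorem cbNorm_nonneg (k : ℕ) (F : E₁ → E₂) : 0 ≤ cbNorm k F :=
  Finset.sum_nonneg fun _ _ => Real.iSup_nonneg fun _ => norm_nonneg _

theorem IsCb.norm_iteratedFDeriv_le {k : ℕ} {F : E₁ → E₂} (hF : IsCb k F) {j : ℕ} (hj : j ≤ k)
    (x : E₁) : ‖iteratedFDeriv ℝ j F x‖ ≤ cbNorm k F := by
  obtain ⟨C, hC⟩ := hF.2 j hj
  refine (le_ciSup (f := fun x => ‖iteratedFDeriv ℝ j F x‖)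
    ⟨C, by rintro _ ⟨y, rfl⟩; exact hC y⟩ x).trans ?_
  exact Finset.single_le_sum (f := fun j => ⨆ x : E₁, ‖iteratedFDeriv ℝ j F x‖)
    (fun _ _ => Real.iSup_nonneg fun _ => norm_nonneg _) (Finset.mem_range.2 (by omega))

theorem norm_sub_le_of_norm_fderiv_le {G : E₁ → E₂} {M : ℝ} (hG : Differentiable ℝ G)
    (hM : ∀ x, ‖fderiv ℝ G x‖ ≤ M) (x y : E₁) : ‖G x - G y‖ ≤ M * ‖x - y‖ :=
  convex_univ.norm_image_sub_le_of_norm_fderiv_le (fun z _ => hG z) (fun z _ => hM z)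
    (Set.mem_univ y) (Set.mem_univ x)

/-- Bound on the difference of two increments of a function with bounded, Lipschitz derivative. -/
theorem norm_increment_sub_increment_le {G : E₁ → E₂} {M : ℝ} (hG : Differentiable ℝ G)
    (hM : ∀ x, ‖fderiv ℝ G x‖ ≤ M)
    (hL : ∀ x y, ‖fderiv ℝ G x - fderiv ℝ G y‖ ≤ M * ‖x - y‖) (b h d k : E₁) :
    ‖(G (b + h) - G b) - (G (d + k) - G d)‖ ≤ M * ‖h - k‖ + M * ‖k‖ * ‖b - d‖ := by
  have h₁ := norm_sub_le_of_norm_fderiv_le hG hM (b + h) (b + k)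
  have hd : ∀ x, HasFDerivAt (fun x => G (x + k) - G x) (fderiv ℝ G (x + k) - fderiv ℝ G x) x :=
    fun x => ((hasFDerivAt_comp_add_right k).2 (hG (x + k)).hasFDerivAt).sub (hG x).hasFDerivAt
  have h₂ := norm_sub_le_of_norm_fderiv_le (G := fun x => G (x + k) - G x) (M := M * ‖k‖)
    (fun x => (hd x).differentiableAt)
    (fun x => by rw [(hd x).fderiv]; simpa using hL (x + k) x) b d
  rw [add_sub_add_left_eq_sub] at h₁
  calc _ = ‖(G (b + h) - G (b + k)) + ((G (b + k) - G b) - (G (d + k) - G d))‖ := by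
        congr 1; abel
    _ ≤ _ := (norm_add_le _ _).trans (add_le_add h₁ h₂)

/-- Bound on the difference of two first-order Taylor remainders. -/
theorem norm_taylor_sub_taylor_le {F : E₁ → E₂} {M : ℝ} (hF : Differentiable ℝ F)
    (hG : Differentiable ℝ (fderiv ℝ F)) (hM : ∀ x, ‖fderiv ℝ (fderiv ℝ F) x‖ ≤ M)
    (hL : ∀ x y, ‖fderiv ℝ (fderiv ℝ F) x - fderiv ℝ (fderiv ℝ F) y‖ ≤ M * ‖x - y‖)
    (b h d k : E₁) :
    ‖(F (b + h) - F b - fderiv ℝ F b h) - (F (d + k) - F d - fderiv ℝ F d k)‖ ≤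
      M * (‖h‖ + ‖k‖) * ‖h - k‖ + M * ‖k‖ ^ 2 * ‖b - d‖ := by
  have hM₀ : 0 ≤ M := (norm_nonneg (fderiv ℝ (fderiv ℝ F) b)).trans (hM b)
  have h₁ : ‖(F (b + h) - F b - fderiv ℝ F b h) - (F (b + k) - F b - fderiv ℝ F b k)‖ ≤
      M * (‖h‖ + ‖k‖) * ‖h - k‖ := by
    have hd : ∀ x, HasFDerivAt (fun x => F (b + x) - F b - fderiv ℝ F b x)
        (fderiv ℝ F (b + x) - fderiv ℝ F b) x := fun x =>
      (((hasFDerivAt_comp_add_left b).2 (hF (b + x)).hasFDerivAt).sub_const _).sub (fderiv ℝ F b).hasFDerivAt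
    refine (convex_closedBall (0 : E₁) (‖h‖ + ‖k‖)).norm_image_sub_le_of_norm_hasFDerivWithin_le
      (f := fun x => F (b + x) - F b - fderiv ℝ F b x)
      (fun x _ => (hd x).hasFDerivWithinAt) (fun x hx => ?_) (by simp) (by simp)
    have h₂ := norm_sub_le_of_norm_fderiv_le hG hM (b + x) b
    rw [add_sub_cancel_left] at h₂
    exact h₂.trans (mul_le_mul_of_nonneg_left (by simpa using hx) hM₀)
  have h₂ : ‖(F (b + k) - F b - fderiv ℝ F b k) - (F (d + k) - F d - fderiv ℝ F d k)‖ ≤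
      M * ‖k‖ ^ 2 * ‖b - d‖ := by
    have hd : ∀ (e : E₁) (r : ℝ), HasDerivAt
        (fun r : ℝ => F (e + r • k) - F e - r • fderiv ℝ F e k)
        (fderiv ℝ F (e + r • k) k - fderiv ℝ F e k) r := fun e r => by
      have hlin : HasDerivAt (fun r : ℝ => r • k) k r := by
        simpa using (hasDerivAt_id r).smul_const k
      have hlin' : HasDerivAt (fun r : ℝ => r • fderiv ℝ F e k) (fderiv ℝ F e k) r := by
        simpa using (hasDerivAt_id r).smul_const (fderiv ℝ F e k)
      exact (((hF (e + r • k)).hasFDerivAt.comp_hasDerivAt r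
        (hlin.const_add e)).sub_const _).sub hlin'
    have h₃ := norm_image_sub_le_of_norm_deriv_le_segment_01'
      (f := fun r : ℝ => (F (b + r • k) - F b - r • fderiv ℝ F b k) -
        (F (d + r • k) - F d - r • fderiv ℝ F d k)) (C := M * ‖k‖ ^ 2 * ‖b - d‖)
      (fun r _ => ((hd b r).sub (hd d r)).hasDerivWithinAt) (fun r hr => ?_)
    · simpa using h₃
    · have h₄ := norm_increment_sub_increment_le hG hM hL b (r • k) d (r • k)
      have h₅ : ‖r • k‖ ≤ ‖k‖ := by
        rw [norm_smul, Real.norm_of_nonneg hr.1]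
        exact mul_le_of_le_one_left (norm_nonneg _) hr.2.le
      simp only [← sub_apply]
      refine (ContinuousLinearMap.le_opNorm _ _).trans ?_
      calc _ ≤ (M * ‖k‖ * ‖b - d‖) * ‖k‖ := by
            gcongr
            refine h₄.trans ?_
            rw [sub_self, norm_zero, mul_zero, zero_add]
            gcongr
        _ = _ := by ring
  calc _ = ‖((F (b + h) - F b - fderiv ℝ F b h) - (F (b + k) - F b - fderiv ℝ F b k)) +
        ((F (b + k) - F b - fderiv ℝ F b k) - (F (d + k) - F d - fderiv ℝ F d k))‖ := by
        rw [sub_add_sub_cancel]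
    _ ≤ _ := (norm_add_le _ _).trans (add_le_add h₁ h₂)

theorem IsCb.norm_fderiv_le {F : E₁ → E₂} (hF : IsCb 3 F) (x : E₁) :
    ‖fderiv ℝ F x‖ ≤ cbNorm 3 F := by
  simpa using hF.norm_iteratedFDeriv_le (j := 1) (by norm_num) x

theorem IsCb.norm_fderiv_fderiv_le {F : E₁ → E₂} (hF : IsCb 3 F) (x : E₁) :
    ‖fderiv ℝ (fderiv ℝ F) x‖ ≤ cbNorm 3 F := by
  have h := hF.norm_iteratedFDeriv_le (j := 2) (by norm_num) x
  rwa [← norm_iteratedFDeriv_fderiv, norm_iteratedFDeriv_one] at h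

theorem IsCb.differentiable {F : E₁ → E₂} (hF : IsCb 3 F) : Differentiable ℝ F :=
  hF.1.differentiable (by norm_num)

theorem IsCb.contDiff_fderiv {F : E₁ → E₂} (hF : IsCb 3 F) : ContDiff ℝ 2 (fderiv ℝ F) :=
  hF.1.fderiv_right (by norm_num)

theorem IsCb.norm_fderiv_fderiv_sub_le {F : E₁ → E₂} (hF : IsCb 3 F) (x y : E₁) :
    ‖fderiv ℝ (fderiv ℝ F) x - fderiv ℝ (fderiv ℝ F) y‖ ≤ cbNorm 3 F * ‖x - y‖ := by
  have h₁ : ContDiff ℝ 1 (fderiv ℝ (fderiv ℝ F)) := hF.contDiff_fderiv.fderiv_right (by norm_num)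
  refine norm_sub_le_of_norm_fderiv_le (h₁.differentiable (by norm_num)) (fun z => ?_) x y
  have h := hF.norm_iteratedFDeriv_le (j := 3) (by norm_num) z
  rwa [← norm_iteratedFDeriv_fderiv, ← norm_iteratedFDeriv_fderiv, norm_iteratedFDeriv_one] at h

end SmoothBounds

section ControlledPaths

variable {V W U : Type*} [NormedAddCommGroup V] [NormedSpace ℝ V]
  [NormedAddCommGroup W] [NormedSpace ℝ W] [NormedAddCommGroup U] [NormedSpace ℝ U]

/-- The increments of a controlled path are Hölder, quantitatively. -/
theorem norm_increment_le_of_controlled {T α K p : ℝ} (hα : 0 ≤ α) (hp : 0 ≤ p)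
    {X : ℝ → V} {Z : ℝ → W} {Z' : ℝ → V →L[ℝ] W}
    (hX : ∀ s t : ℝ, 0 ≤ s → s < t → t ≤ T → ‖X t - X s‖ ≤ K * (t - s) ^ α)
    (hZ₀ : ‖Z' 0‖ ≤ p)
    (hZ' : ∀ s t : ℝ, 0 ≤ s → s < t → t ≤ T → ‖Z' t - Z' s‖ ≤ p * (t - s) ^ α)
    (hR : ∀ s t : ℝ, 0 ≤ s → s < t → t ≤ T → ‖Rem X Z Z' s t‖ ≤ p * (t - s) ^ (2 * α))
    {s t : ℝ} (hs : 0 ≤ s) (hst : s < t) (ht : t ≤ T) :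
    ‖Z t - Z s‖ ≤ p * ((1 + T ^ α) * (K + 1)) * (t - s) ^ α := by
  have h₁ : ‖Z' s‖ ≤ p * (1 + T ^ α) := by
    have := norm_le_of_holder hα hp hZ' hs (hst.le.trans ht)
    linarith
  have h₂ : (t - s) ^ α ≤ 1 + T ^ α := by
    have : (t - s) ^ α ≤ T ^ α := Real.rpow_le_rpow (by linarith) (by linarith) hα
    linarith
  have hτ : 0 ≤ (t - s) ^ α := Real.rpow_nonneg (by linarith) _
  have h₃ := hR s t hs hst ht
  rw [two_mul, Real.rpow_add (by linarith)] at h₃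
  have h₄ : ‖Z' s (X t - X s)‖ ≤ p * (1 + T ^ α) * (K * (t - s) ^ α) :=
    (Z' s).le_of_opNorm_le_of_le h₁ (hX s t hs hst ht)
  have h₅ : Z t - Z s = Z' s (X t - X s) + Rem X Z Z' s t := by
    simp only [Rem]; abel
  rw [h₅]
  refine (norm_add_le _ _).trans ((add_le_add h₄ h₃).trans ?_)
  have h₆ : p * ((t - s) ^ α * (t - s) ^ α) ≤ p * ((1 + T ^ α) * (t - s) ^ α) := by gcongr
  linarith

theorem norm_comp_deriv_sub_le {G : W → W →L[ℝ] U} {M : ℝ} (hG : Differentiable ℝ G)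
    (hM₀ : ∀ x, ‖G x‖ ≤ M) (hM : ∀ x, ‖fderiv ℝ G x‖ ≤ M)
    (hL : ∀ x y, ‖fderiv ℝ G x - fderiv ℝ G y‖ ≤ M * ‖x - y‖)
    (y₀ y₁ z₀ z₁ : W) (a₀ a₁ b₀ b₁ : V →L[ℝ] W) :
    ‖((G y₁).comp a₁ - (G y₀).comp a₀) - ((G z₁).comp b₁ - (G z₀).comp b₀)‖ ≤
      (M * ‖(y₁ - y₀) - (z₁ - z₀)‖ + M * ‖z₁ - z₀‖ * ‖y₀ - z₀‖) * ‖a₁‖ +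
      M * ‖z₁ - z₀‖ * ‖a₁ - b₁‖ + M * ‖y₀ - z₀‖ * ‖a₁ - a₀‖ +
      M * ‖(a₁ - a₀) - (b₁ - b₀)‖ := by
  have key : ((G y₁).comp a₁ - (G y₀).comp a₀) - ((G z₁).comp b₁ - (G z₀).comp b₀) =
      ((G y₁ - G y₀) - (G z₁ - G z₀)).comp a₁ + (G z₁ - G z₀).comp (a₁ - b₁) +
      (G y₀ - G z₀).comp (a₁ - a₀) + (G z₀).comp ((a₁ - a₀) - (b₁ - b₀)) := by
    ext v
    simp only [sub_apply, add_apply,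
      ContinuousLinearMap.comp_apply, map_sub]
    abel
  have h := norm_increment_sub_increment_le hG hM hL y₀ (y₁ - y₀) z₀ (z₁ - z₀)
  simp only [add_sub_cancel] at h
  rw [key]
  refine norm_add_le_of_le (norm_add_le_of_le (norm_add_le_of_le ?_ ?_) ?_) ?_ <;>
    refine (ContinuousLinearMap.opNorm_comp_le _ _).trans
      (mul_le_mul_of_nonneg_right ?_ (norm_nonneg _))
  · exact h
  · exact norm_sub_le_of_norm_fderiv_le hG hM _ _
  · exact norm_sub_le_of_norm_fderiv_le hG hM _ _
  · exact hM₀ _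

theorem norm_rem_comp_sub_le {F : W → U} {M : ℝ} (hF : Differentiable ℝ F)
    (hG : Differentiable ℝ (fderiv ℝ F)) (hM₀ : ∀ x, ‖fderiv ℝ F x‖ ≤ M)
    (hM : ∀ x, ‖fderiv ℝ (fderiv ℝ F) x‖ ≤ M)
    (hL : ∀ x y, ‖fderiv ℝ (fderiv ℝ F) x - fderiv ℝ (fderiv ℝ F) y‖ ≤ M * ‖x - y‖)
    (X : ℝ → V) (Y Z : ℝ → W) (Y' Z' : ℝ → V →L[ℝ] W) (s t : ℝ) :
    ‖Rem X (fun t => F (Y t)) (fun t => (fderiv ℝ F (Y t)).comp (Y' t)) s t -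
        Rem X (fun t => F (Z t)) (fun t => (fderiv ℝ F (Z t)).comp (Z' t)) s t‖ ≤
      M * (‖Y t - Y s‖ + ‖Z t - Z s‖) * ‖(Y t - Y s) - (Z t - Z s)‖ +
      M * ‖Z t - Z s‖ ^ 2 * ‖Y s - Z s‖ + M * ‖Y s - Z s‖ * ‖Rem X Y Y' s t‖ +
      M * ‖Rem X Y Y' s t - Rem X Z Z' s t‖ := by
  have h := norm_taylor_sub_taylor_le hF hG hM hL (Y s) (Y t - Y s) (Z s) (Z t - Z s)
  simp only [add_sub_cancel] at h
  have key : Rem X (fun t => F (Y t)) (fun t => (fderiv ℝ F (Y t)).comp (Y' t)) s t -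
        Rem X (fun t => F (Z t)) (fun t => (fderiv ℝ F (Z t)).comp (Z' t)) s t =
      ((F (Y t) - F (Y s) - fderiv ℝ F (Y s) (Y t - Y s)) -
        (F (Z t) - F (Z s) - fderiv ℝ F (Z s) (Z t - Z s))) +
      (fderiv ℝ F (Y s) - fderiv ℝ F (Z s)) (Rem X Y Y' s t) +
      fderiv ℝ F (Z s) (Rem X Y Y' s t - Rem X Z Z' s t) := by
    simp only [Rem, sub_apply, ContinuousLinearMap.comp_apply, map_sub]
    abel
  rw [key]
  refine norm_add_le_of_le (norm_add_le_of_le h ?_) ?_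
  · exact ContinuousLinearMap.le_of_opNorm_le _ (norm_sub_le_of_norm_fderiv_le hG hM _ _) _
  · exact ContinuousLinearMap.le_of_opNorm_le _ (hM₀ _) _

end ControlledPaths

/-- local Lipschitz estimate for composition with a `C_b^3` map. -/
theorem stmt10
    {V V2 W U : Type*} [NormedAddCommGroup V] [NormedSpace ℝ V] [CompleteSpace V]
    [NormedAddCommGroup V2] [NormedSpace ℝ V2] [CompleteSpace V2]
    [NormedAddCommGroup W] [NormedSpace ℝ W] [CompleteSpace W]
    [NormedAddCommGroup U] [NormedSpace ℝ U] [CompleteSpace U]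
    (T α : ℝ) (hT : 0 < T) (hα : 1 / 3 < α) (hα' : α ≤ 1 / 2)
    (tmul : V →L[ℝ] V →L[ℝ] V2) (htmul : ∀ a b : V, ‖tmul a b‖ ≤ ‖a‖ * ‖b‖) :
    ∀ K : ℝ, 0 < K → ∃ C : ℝ, 0 < C ∧
      ∀ (X : ℝ → V) (XX : ℝ → ℝ → V2), IsRoughPath T α tmul X XX →
        rpNorm T α X XX ≤ K →
      ∀ (Y Yt : ℝ → W) (Y' Yt' : ℝ → V →L[ℝ] W),
        IsCRP T α X Y Y' → IsCRP T α X Yt Yt' →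
        ‖Y' 0‖ ≤ K → ‖Yt' 0‖ ≤ K →
        crpNorm T α X Y Y' ≤ K → crpNorm T α X Yt Yt' ≤ K →
      ∀ F : W → U, IsCb 3 F →
        crpDist T α X X (fun t => F (Y t)) (fun t => (fderiv ℝ F (Y t)).comp (Y' t))
            (fun t => F (Yt t)) (fun t => (fderiv ℝ F (Yt t)).comp (Yt' t)) ≤
          C * cbNorm 3 F *
            (crpDist T α X X Y Y' Yt Yt' + ‖Y 0 - Yt 0‖ + ‖Y' 0 - Yt' 0‖) := by
  intro K hK
  have hα₀ : 0 ≤ α := by linarith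
  obtain ⟨a, ha⟩ : ∃ a, a = 1 + T ^ α := ⟨_, rfl⟩
  have hTα : 0 ≤ T ^ α := Real.rpow_nonneg hT.le _
  have ha₁ : 1 ≤ a := by linarith
  have ha₀ : 0 < a := by linarith
  obtain ⟨c, hc⟩ : ∃ c, c = a * (K + 1) := ⟨_, rfl⟩
  have hc₀ : 0 < c := by rw [hc]; positivity
  obtain ⟨H, hH⟩ : ∃ H, H = K * c := ⟨_, rfl⟩
  have hH₀ : 0 < H := by rw [hH]; positivity
  obtain ⟨e, he⟩ : ∃ e, e = 1 + c * a := ⟨_, rfl⟩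
  have he₀ : 0 < e := by rw [he]; positivity
  refine ⟨((H + H) * c + H ^ 2 * e + e * K + 1) +
    ((c + H * e) * (K * a) + H * a + e * K + 1), by positivity, ?_⟩
  intro X XX hX hXK Y Yt Y' Yt' hY hYt hY0 hYt0 hYK hYtK F hF
  have hXb : ∀ s t : ℝ, 0 ≤ s → s < t → t ≤ T → ‖X t - X s‖ ≤ K * (t - s) ^ α := by
    intro s t hs hst ht
    refine (hX.x_hold.norm_le hs hst ht).trans ?_
    have h₁ : 0 ≤ hnorm T (2 * α) XX := hnorm_nonneg
    unfold rpNorm at hXK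
    exact mul_le_mul_of_nonneg_right (by linarith) (Real.rpow_nonneg (by linarith) _)
  have hcrp : ∀ (Z : ℝ → W) (Z' : ℝ → V →L[ℝ] W), IsCRP T α X Z Z' → crpNorm T α X Z Z' ≤ K →
      (∀ s t : ℝ, 0 ≤ s → s < t → t ≤ T → ‖Z' t - Z' s‖ ≤ K * (t - s) ^ α) ∧
      (∀ s t : ℝ, 0 ≤ s → s < t → t ≤ T → ‖Rem X Z Z' s t‖ ≤ K * (t - s) ^ (2 * α)) := by
    intro Z Z' hZ hZK
    have h₁ : 0 ≤ hnorm T (2 * α) (Rem X Z Z') := hnorm_nonneg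
    have h₂ : 0 ≤ hnorm T α fun s t => Z' t - Z' s := hnorm_nonneg
    unfold crpNorm at hZK
    refine ⟨fun s t hs hst ht => (hZ.deriv_hold.norm_le hs hst ht).trans ?_,
      fun s t hs hst ht => (hZ.rem_hold.norm_le hs hst ht).trans ?_⟩ <;>
    exact mul_le_mul_of_nonneg_right (by linarith) (Real.rpow_nonneg (by linarith) _)
  obtain ⟨hY'b, hRb⟩ := hcrp Y Y' hY hYK
  obtain ⟨hYt'b, hRtb⟩ := hcrp Yt Yt' hYt hYtK
  obtain ⟨D, hD⟩ : ∃ D, D = crpDist T α X X Y Y' Yt Yt' + ‖Y 0 - Yt 0‖ + ‖Y' 0 - Yt' 0‖ :=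
    ⟨_, rfl⟩
  rw [← hD]
  have hd₁ : 0 ≤ hnorm T (2 * α) fun s t => Rem X Y Y' s t - Rem X Yt Yt' s t := hnorm_nonneg
  have hd₂ : 0 ≤ hnorm T α fun s t => (Y' t - Y' s) - (Yt' t - Yt' s) := hnorm_nonneg
  have hn₁ := norm_nonneg (Y 0 - Yt 0)
  have hn₂ := norm_nonneg (Y' 0 - Yt' 0)
  unfold crpDist at hD
  have hD₀ : 0 ≤ D := by linarith
  have hΔ' : ∀ s t : ℝ, 0 ≤ s → s < t → t ≤ T →
      ‖(Y' t - Y' s) - (Yt' t - Yt' s)‖ ≤ D * (t - s) ^ α := fun s t hs hst ht =>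
    ((hY.deriv_hold.sub hYt.deriv_hold).norm_le hs hst ht).trans
      (mul_le_mul_of_nonneg_right (by linarith) (Real.rpow_nonneg (by linarith) _))
  have hΔR : ∀ s t : ℝ, 0 ≤ s → s < t → t ≤ T →
      ‖Rem X Y Y' s t - Rem X Yt Yt' s t‖ ≤ D * (t - s) ^ (2 * α) := fun s t hs hst ht =>
    ((hY.rem_hold.sub hYt.rem_hold).norm_le hs hst ht).trans
      (mul_le_mul_of_nonneg_right (by linarith) (Real.rpow_nonneg (by linarith) _))
  have hYi : ∀ s t : ℝ, 0 ≤ s → s < t → t ≤ T → ‖Y t - Y s‖ ≤ H * (t - s) ^ α := by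
    intro s t hs hst ht
    rw [hH, hc, ha]
    exact norm_increment_le_of_controlled hα₀ hK.le hXb hY0 hY'b hRb hs hst ht
  have hYti : ∀ s t : ℝ, 0 ≤ s → s < t → t ≤ T → ‖Yt t - Yt s‖ ≤ H * (t - s) ^ α := by
    intro s t hs hst ht
    rw [hH, hc, ha]
    exact norm_increment_le_of_controlled hα₀ hK.le hXb hYt0 hYt'b hRtb hs hst ht
  have hΔ'b : ∀ s t : ℝ, 0 ≤ s → s < t → t ≤ T →
      ‖(Y' t - Yt' t) - (Y' s - Yt' s)‖ ≤ D * (t - s) ^ α := by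
    intro s t hs hst ht
    rw [sub_sub_sub_comm]
    exact hΔ' s t hs hst ht
  have hΔi : ∀ s t : ℝ, 0 ≤ s → s < t → t ≤ T →
      ‖(Y t - Yt t) - (Y s - Yt s)‖ ≤ D * c * (t - s) ^ α := by
    intro s t hs hst ht
    rw [hc, ha]
    refine norm_increment_le_of_controlled (Z := fun t => Y t - Yt t)
      (Z' := fun t => Y' t - Yt' t) hα₀ hD₀ hXb (by linarith) hΔ'b
      (fun s t hs hst ht => ?_) hs hst ht
    have : Rem X (fun t => Y t - Yt t) (fun t => Y' t - Yt' t) s t =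
        Rem X Y Y' s t - Rem X Yt Yt' s t := by
      simp only [Rem, sub_apply]; abel
    rw [this]
    exact hΔR s t hs hst ht
  have hY't : ∀ t, 0 ≤ t → t ≤ T → ‖Y' t‖ ≤ K * a := by
    intro t h0 h1
    have := norm_le_of_holder hα₀ hK.le hY'b h0 h1
    rw [ha]; linarith
  have hΔ't : ∀ t, 0 ≤ t → t ≤ T → ‖Y' t - Yt' t‖ ≤ D * a := by
    intro t h0 h1
    have := norm_le_of_holder (Z := fun t => Y' t - Yt' t) hα₀ hD₀ hΔ'b h0 h1
    rw [ha]; linarith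
  have hΔt : ∀ t, 0 ≤ t → t ≤ T → ‖Y t - Yt t‖ ≤ D * e := by
    intro t h0 h1
    have h₁ := norm_le_of_holder (Z := fun t => Y t - Yt t) hα₀ (by positivity) hΔi h0 h1
    have h₂ : D * c * T ^ α ≤ D * c * a := mul_le_mul_of_nonneg_left (by linarith) (by positivity)
    rw [he]; linarith
  obtain ⟨M, hM⟩ : ∃ M, M = cbNorm 3 F := ⟨_, rfl⟩
  have hM₀ : 0 ≤ M := hM ▸ cbNorm_nonneg 3 F
  have hF₁ := hF.norm_fderiv_le
  have hF₂ := hF.norm_fderiv_fderiv_le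
  have hF₃ := hF.norm_fderiv_fderiv_sub_le
  have hdF := hF.differentiable
  have hdG : Differentiable ℝ (fderiv ℝ F) := hF.contDiff_fderiv.differentiable (by norm_num)
  rw [← hM] at hF₁ hF₂ hF₃ ⊢
  rw [add_mul, add_mul]
  refine add_le_add (hnorm_le (by positivity) fun s t hs hst ht => ?_)
    (hnorm_le (by positivity) fun s t hs hst ht => ?_)
  · refine (norm_rem_comp_sub_le hdF hdG hF₁ hF₂ hF₃ X Y Yt Y' Yt' s t).trans ?_
    have h₁ := hYi s t hs hst ht
    have h₂ := hYti s t hs hst ht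
    have h₃ := hΔi s t hs hst ht
    rw [sub_sub_sub_comm] at h₃
    have h₄ := hΔt s hs (hst.le.trans ht)
    have h₅ := hRb s t hs hst ht
    have h₆ := hΔR s t hs hst ht
    have hτ : (t - s) ^ (2 * α) = (t - s) ^ α * (t - s) ^ α := by
      rw [two_mul, Real.rpow_add (by linarith)]
    have hτ₀ : 0 ≤ (t - s) ^ α := Real.rpow_nonneg (by linarith) _
    rw [hτ] at h₅ h₆ ⊢
    generalize (t - s) ^ α = τ at *
    calc _ ≤ M * (H * τ + H * τ) * (D * c * τ) + M * (H * τ) ^ 2 * (D * e) +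
          M * (D * e) * (K * (τ * τ)) + M * (D * (τ * τ)) := by gcongr
      _ = _ := by ring
  · refine (norm_comp_deriv_sub_le hdG hF₁ hF₂ hF₃ (Y s) (Y t) (Yt s) (Yt t)
      (Y' s) (Y' t) (Yt' s) (Yt' t)).trans ?_
    have h₂ := hYti s t hs hst ht
    have h₃ := hΔi s t hs hst ht
    rw [sub_sub_sub_comm] at h₃
    have h₄ := hΔt s hs (hst.le.trans ht)
    have h₅ := hY't t (hs.trans hst.le) ht
    have h₆ := hΔ't t (hs.trans hst.le) ht
    have h₇ := hY'b s t hs hst ht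
    have h₈ := hΔ' s t hs hst ht
    have hτ₀ : 0 ≤ (t - s) ^ α := Real.rpow_nonneg (by linarith) _
    generalize (t - s) ^ α = τ at *
    calc _ ≤ (M * (D * c * τ) + M * (H * τ) * (D * e)) * (K * a) + M * (H * τ) * (D * a) +
          M * (D * e) * (K * τ) + M * (D * τ) := by gcongr
      _ = _ := by ring
end
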